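/- Let μ be an absolutely continuous probability measure on S¹ and let ν, ν₁, ν₂, … be absolutely continuous probability measures on S¹ with W₂(ν_n, ν) → 0. Then: (a) for every θ ∈ ℝ, C_{[ν_n,μ]}(θ) → C_{[ν,μ]}(θ) as n → ∞; and (b) if θ_n is a minimizer of C_{[ν_n,μ]} for each n and the sequence (θ_n) lies in a compact interval, then every limit point of (θ_n) is a minimizer of C_{[ν,μ]}. -/

import Mathlib

open MeasureTheory Real Set Filter Topology

noncomputable section

instance : Fact (0 < 2 * Real.pi) := ⟨by positivity⟩

/-- The circle `ℝ / 2πℤ`. -/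
abbrev S1 : Type := AddCircle (2 * Real.pi)

/-- The quotient projection `exp_c : ℝ → S¹`. -/
def expc (x : ℝ) : S1 := (x : S1)

/-- The canonical right inverse `log_c : S¹ → [0, 2π)`. -/
def logc (z : S1) : ℝ := (AddCircle.equivIco (2 * Real.pi) 0 z : ℝ)

/-- Squared 2-Wasserstein distance: infimum of `∫ d(x,y)² dγ` over couplings `γ`. -/
def W2sq {X : Type*} [MeasurableSpace X] [PseudoMetricSpace X]
    (μ ν : Measure X) : ℝ :=
  sInf { c : ℝ | ∃ γ : Measure (X × X), IsProbabilityMeasure γ ∧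
      γ.map Prod.fst = μ ∧ γ.map Prod.snd = ν ∧
      c = ∫ p, dist p.1 p.2 ^ 2 ∂γ }

/-- `T` is an optimal transport map from `μ` to `ν`. -/
def IsOTM (μ ν : Measure S1) (T : S1 → S1) : Prop :=
  Measurable T ∧ μ.map T = ν ∧ (∫ z, dist z (T z) ^ 2 ∂μ) = W2sq μ ν

/-- `μ̃`, the pushforward of a measure on `S¹` to `[0, 2π) ⊆ ℝ` via `log_c`. -/
def tilde (μ : Measure S1) : Measure ℝ := μ.map logc

/-- The periodic cumulative distribution function of a (periodicised) measure on `[0,2π)`: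
`F(x) = μ̃([0,x))` for `x ∈ [0,2π]`, extended by `F(x + 2π) = F(x) + 1`. -/
def cdf (μt : Measure ℝ) (x : ℝ) : ℝ :=
  ⌊x / (2 * π)⌋ + (μt (Set.Ico 0 (Int.fract (x / (2 * π)) * (2 * π)))).toReal

/-- The quantile function (generalized inverse) of the periodic cdf. -/
def qf (μt : Measure ℝ) (u : ℝ) : ℝ := sInf { x : ℝ | u ≤ cdf μt x }

/-- The cost `C_{[μ,ν]}(θ) = ∫₀¹ (F_μ̃⁻(u) − F_ν̃⁻(u−θ))² du`. -/
def cost (μ ν : Measure S1) (θ : ℝ) : ℝ :=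
  ∫ u in (0:ℝ)..1, (qf (tilde μ) u - qf (tilde ν) (u - θ)) ^ 2


lemma cdf_monotone (μt : Measure ℝ) [IsProbabilityMeasure μt] : Monotone (cdf μt) := by
  intro x y hxy
  have hp : (0 : ℝ) < 2 * π := by positivity
  have hdiv : x / (2 * π) ≤ y / (2 * π) := by gcongr
  unfold cdf
  rcases (Int.floor_mono hdiv).eq_or_lt with h | h
  · have hfract : Int.fract (x / (2 * π)) ≤ Int.fract (y / (2 * π)) := by
      rw [Int.fract, Int.fract, h]
      linarith
    rw [h]
    gcongr
    exact measure_ne_top _ _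
  · have h1 : (⌊x / (2 * π)⌋ : ℝ) + 1 ≤ ⌊y / (2 * π)⌋ := by exact_mod_cast h
    have h2 : (μt (Ico 0 (Int.fract (x / (2 * π)) * (2 * π)))).toReal ≤ 1 :=
      measureReal_le_one
    have h3 : 0 ≤ (μt (Ico 0 (Int.fract (y / (2 * π)) * (2 * π)))).toReal :=
      ENNReal.toReal_nonneg
    linarith

lemma sub_one_le_cdf (μt : Measure ℝ) (x : ℝ) : x / (2 * π) - 1 ≤ cdf μt x := by
  have h1 := Int.lt_floor_add_one (x / (2 * π))
  have h2 : 0 ≤ (μt (Ico 0 (Int.fract (x / (2 * π)) * (2 * π)))).toReal :=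
    ENNReal.toReal_nonneg
  unfold cdf
  linarith

lemma cdf_le_add_one (μt : Measure ℝ) [IsProbabilityMeasure μt] (x : ℝ) :
    cdf μt x ≤ x / (2 * π) + 1 := by
  have h1 := Int.floor_le (x / (2 * π))
  have h2 : (μt (Ico 0 (Int.fract (x / (2 * π)) * (2 * π)))).toReal ≤ 1 :=
    measureReal_le_one
  unfold cdf
  linarith

lemma mem_lowerBounds_quantile (μt : Measure ℝ) [IsProbabilityMeasure μt] (u : ℝ) :
    2 * π * (u - 1) ∈ lowerBounds {x : ℝ | u ≤ cdf μt x} := by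
  intro x hx
  have h := (show u ≤ cdf μt x from hx).trans (cdf_le_add_one μt x)
  have hp : (0 : ℝ) < 2 * π := by positivity
  have h2 : u - 1 ≤ x / (2 * π) := by linarith
  rw [le_div_iff₀ hp] at h2
  linarith

lemma mem_quantile_set (μt : Measure ℝ) (u : ℝ) :
    2 * π * (u + 1) ∈ {x : ℝ | u ≤ cdf μt x} := by
  have h := sub_one_le_cdf μt (2 * π * (u + 1))
  have hp : (0 : ℝ) < 2 * π := by positivity
  rw [mul_div_cancel_left₀ _ hp.ne'] at h
  simp only [mem_ofPred_eq]
  linarith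

lemma qf_le_of_le_cdf (μt : Measure ℝ) [IsProbabilityMeasure μt] {u x : ℝ}
    (h : u ≤ cdf μt x) : qf μt u ≤ x :=
  csInf_le ⟨_, mem_lowerBounds_quantile μt u⟩ h

lemma le_cdf_of_qf_lt (μt : Measure ℝ) [IsProbabilityMeasure μt] {u x : ℝ}
    (h : qf μt u < x) : u ≤ cdf μt x := by
  obtain ⟨y, hy, hyx⟩ := exists_lt_of_csInf_lt ⟨_, mem_quantile_set μt u⟩ h
  exact le_trans hy (cdf_monotone μt hyx.le)

lemma qf_monotone (μt : Measure ℝ) [IsProbabilityMeasure μt] : Monotone (qf μt) :=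
  fun _ v huv => csInf_le_csInf ⟨_, mem_lowerBounds_quantile μt _⟩
    ⟨_, mem_quantile_set μt v⟩ fun _ hx => huv.trans hx

lemma abs_qf_sub_le (μt : Measure ℝ) [IsProbabilityMeasure μt] (u : ℝ) :
    |qf μt u - 2 * π * u| ≤ 2 * π := by
  have h1 : qf μt u ≤ 2 * π * (u + 1) := qf_le_of_le_cdf μt (mem_quantile_set μt u)
  have h2 : 2 * π * (u - 1) ≤ qf μt u :=
    le_csInf ⟨_, mem_quantile_set μt u⟩ (mem_lowerBounds_quantile μt u)
  rw [abs_le]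
  constructor <;> linarith

/-- Pointwise convergence of periodic cdfs implies convergence of the quantile functions at every
continuity point of the limit. -/
lemma tendsto_qf {ι : Type*} {l : Filter ι} {μs : ι → Measure ℝ} {μt : Measure ℝ}
    [∀ i, IsProbabilityMeasure (μs i)] [IsProbabilityMeasure μt]
    (h : ∀ x, Tendsto (fun i => cdf (μs i) x) l (𝓝 (cdf μt x))) {u : ℝ}
    (hu : ContinuousAt (qf μt) u) :
    Tendsto (fun i => qf (μs i) u) l (𝓝 (qf μt u)) := by
  rw [tendsto_order]
  constructor
  · intro a ha
    obtain ⟨x, hax, hx⟩ := exists_between ha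
    have hlt : cdf μt x < u := by
      by_contra! hle
      exact absurd (qf_le_of_le_cdf μt hle) (not_le.2 hx)
    filter_upwards [(h x).eventually_lt_const hlt] with i hi
    by_contra! hle
    exact absurd (le_cdf_of_qf_lt (μs i) (hle.trans_lt hax)) (not_le.2 hi)
  · intro b hb
    obtain ⟨v, hv, huv⟩ : ∃ v, qf μt v < b ∧ u < v := by
      have h1 : ∀ᶠ v in 𝓝[>] u, qf μt v < b :=
        (hu.eventually_lt_const hb).filter_mono nhdsWithin_le_nhds
      exact (h1.and self_mem_nhdsWithin).exists
    obtain ⟨x, hvx, hxb⟩ := exists_between hv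
    filter_upwards [(h x).eventually_const_lt (huv.trans_le (le_cdf_of_qf_lt μt hvx))] with i hi
    exact (qf_le_of_le_cdf (μs i) hi.le).trans_lt hxb

lemma measurable_logc : Measurable logc :=
  measurable_subtype_coe.comp (AddCircle.measurableEquivIco (2 * π) 0).measurable

instance (μ : Measure S1) [IsProbabilityMeasure μ] : IsProbabilityMeasure (tilde μ) :=
  Measure.isProbabilityMeasure_map measurable_logc.aemeasurable

/-- The cost depends continuously on the shift and on the cdf of the first measure. -/
lemma tendsto_cost {ι : Type*} {l : Filter ι} [l.IsCountablyGenerated]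
    {νs : ι → Measure S1} {ν μ : Measure S1} [∀ i, IsProbabilityMeasure (νs i)]
    [IsProbabilityMeasure ν] [IsProbabilityMeasure μ]
    (h : ∀ x, Tendsto (fun i => cdf (tilde (νs i)) x) l (𝓝 (cdf (tilde ν) x)))
    {θs : ι → ℝ} {θ : ℝ} (hθ : Tendsto θs l (𝓝 θ)) :
    Tendsto (fun i => cost (νs i) μ (θs i)) l (𝓝 (cost ν μ θ)) := by
  unfold cost
  refine intervalIntegral.tendsto_integral_filter_of_dominated_convergence
    (fun _ => (2 * π * (3 + |θ|)) ^ 2) ?_ ?_ intervalIntegrable_const ?_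
  · refine Eventually.of_forall fun i => Measurable.aestronglyMeasurable ?_
    exact (((qf_monotone _).measurable).sub
      ((qf_monotone _).measurable.comp (measurable_id.sub_const _))).pow_const 2
  · have hb : ∀ᶠ i in l, |θs i| < |θ| + 1 :=
      hθ.abs.eventually_lt_const (lt_add_one _)
    filter_upwards [hb] with i hi
    refine Eventually.of_forall fun u _ => ?_
    rw [Real.norm_eq_abs, abs_pow]
    have h1 := abs_le.1 (abs_qf_sub_le (tilde (νs i)) u)
    have h2 := abs_le.1 (abs_qf_sub_le (tilde μ) (u - θs i))
    have h3 := abs_lt.1 hi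
    have h4 : 2 * π * θs i ≤ 2 * π * (|θ| + 1) := by gcongr; exact h3.2.le
    have h5 : 2 * π * (-(|θ| + 1)) ≤ 2 * π * θs i := by gcongr; exact h3.1.le
    gcongr
    rw [abs_le]
    constructor <;> linarith
  · have c1 := ((qf_monotone (tilde ν)).countable_not_continuousAt).ae_notMem volume
    have c2 := (((qf_monotone (tilde μ)).countable_not_continuousAt).preimage
      (sub_left_injective (b := θ))).ae_notMem volume
    filter_upwards [c1, c2] with u h1 h2 _
    simp only [mem_ofPred_eq, mem_preimage, not_not] at h1 h2
    exact ((tendsto_qf h h1).sub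
      (h2.tendsto.comp (tendsto_const_nhds.sub hθ))).pow 2

lemma integrable_dist_sq (γ : Measure (S1 × S1)) [IsProbabilityMeasure γ] :
    Integrable (fun p : S1 × S1 => dist p.1 p.2 ^ 2) γ :=
  (by fun_prop : Continuous fun p : S1 × S1 => dist p.1 p.2 ^ 2).integrable_of_hasCompactSupport
    (HasCompactSupport.of_compactSpace _)

/-- The Kantorovich bound for Lipschitz test functions, by the weighted arithmetic-geometric
inequality. -/
lemma abs_integral_sub_le_of_coupling {μ ν : Measure S1} (γ : Measure (S1 × S1))
    [IsProbabilityMeasure γ] (h₁ : γ.map Prod.fst = μ) (h₂ : γ.map Prod.snd = ν)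
    {f : S1 → ℝ} {L : NNReal} (hf : LipschitzWith L f) {δ : ℝ} (hδ : 0 < δ) :
    |∫ x, f x ∂μ - ∫ x, f x ∂ν| ≤ L * (δ + (∫ p, dist p.1 p.2 ^ 2 ∂γ) / δ) := by
  have hc := hf.continuous
  have hi1 : Integrable (fun p : S1 × S1 => f p.1) γ :=
    (hc.comp continuous_fst).integrable_of_hasCompactSupport (HasCompactSupport.of_compactSpace _)
  have hi2 : Integrable (fun p : S1 × S1 => f p.2) γ :=
    (hc.comp continuous_snd).integrable_of_hasCompactSupport (HasCompactSupport.of_compactSpace _)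
  rw [← h₁, ← h₂, integral_map measurable_fst.aemeasurable hc.aestronglyMeasurable,
    integral_map measurable_snd.aemeasurable hc.aestronglyMeasurable, ← integral_sub hi1 hi2]
  have hd := (integrable_dist_sq γ).div_const δ
  calc |∫ p, (f p.1 - f p.2) ∂γ| ≤ ∫ p, |f p.1 - f p.2| ∂γ := abs_integral_le_integral_abs
    _ ≤ ∫ p, L * (δ + dist p.1 p.2 ^ 2 / δ) ∂γ := by
        refine integral_mono (hi1.sub hi2).abs (((integrable_const δ).add hd).const_mul _) ?_
        intro p
        refine (hf.dist_le_mul p.1 p.2).trans (mul_le_mul_of_nonneg_left ?_ L.2)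
        rw [← sub_nonneg, show δ + dist p.1 p.2 ^ 2 / δ - dist p.1 p.2 =
          ((dist p.1 p.2 - δ / 2) ^ 2 + 3 / 4 * δ ^ 2) / δ by field_simp; ring]
        positivity
    _ = L * (δ + (∫ p, dist p.1 p.2 ^ 2 ∂γ) / δ) := by
        rw [integral_const_mul, integral_add (integrable_const δ) hd, integral_div]
        simp

lemma exists_coupling_lt {μ ν : Measure S1} [IsProbabilityMeasure μ] [IsProbabilityMeasure ν]
    {c : ℝ} (h : W2sq μ ν < c) :
    ∃ γ : Measure (S1 × S1), IsProbabilityMeasure γ ∧ γ.map Prod.fst = μ ∧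
      γ.map Prod.snd = ν ∧ ∫ p, dist p.1 p.2 ^ 2 ∂γ < c := by
  have hne : { c : ℝ | ∃ γ : Measure (S1 × S1), IsProbabilityMeasure γ ∧ γ.map Prod.fst = μ ∧
      γ.map Prod.snd = ν ∧ c = ∫ p, dist p.1 p.2 ^ 2 ∂γ }.Nonempty :=
    ⟨_, μ.prod ν, inferInstance, by simp, by simp, rfl⟩
  obtain ⟨b, ⟨γ, hγ, h₁, h₂, rfl⟩, hb⟩ := exists_lt_of_csInf_lt hne h
  exact ⟨γ, hγ, h₁, h₂, hb⟩

/-- Convergence in the Wasserstein distance implies weak convergence. -/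
lemma tendsto_probabilityMeasure_of_W2 {ι : Type*} {l : Filter ι} [l.IsCountablyGenerated]
    {νs : ι → ProbabilityMeasure S1} {ν : ProbabilityMeasure S1}
    (h : Tendsto (fun i => √(W2sq (νs i : Measure S1) ν)) l (𝓝 0)) :
    Tendsto νs l (𝓝 ν) := by
  rw [tendsto_iff_forall_lipschitz_integral_tendsto]
  rintro f - ⟨L, hL⟩
  rw [Metric.tendsto_nhds]
  intro ε hε
  set δ : ℝ := ε / (2 * L + 1) with hδ_def
  have hδ : 0 < δ := by positivity
  filter_upwards [h.eventually_lt_const hδ] with i hi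
  have hW : W2sq (νs i : Measure S1) ν < δ ^ 2 := (Real.sqrt_lt' hδ).1 hi
  obtain ⟨γ, hγ, h₁, h₂, hc⟩ := exists_coupling_lt hW
  have hdiv : (∫ p, dist p.1 p.2 ^ 2 ∂γ) / δ ≤ δ := by
    rw [div_le_iff₀ hδ]
    nlinarith
  have hle := abs_integral_sub_le_of_coupling γ h₁ h₂ hL hδ
  have hεδ : ε = δ * (2 * L + 1) := by rw [hδ_def]; field_simp
  rw [Real.dist_eq]
  have hL0 : (0 : ℝ) ≤ L := L.2
  calc _ ≤ _ := hle
    _ ≤ L * (δ + δ) := by gcongr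
    _ < ε := by rw [hεδ]; linarith

lemma frontier_logc_preimage_Ico_subset (y : ℝ) :
    frontier (logc ⁻¹' Ico 0 y) ⊆ {((0 : ℝ) : S1), (y : S1)} := by
  intro z hz
  by_contra hne
  simp only [mem_insert_iff, mem_singleton_iff, not_or] at hne
  have hcont : ContinuousAt logc z :=
    continuousAt_subtype_val.comp (AddCircle.continuousAt_equivIco (2 * π) 0 hne.1)
  have hpos : ∀ w, 0 ≤ logc w := fun w => (AddCircle.equivIco (2 * π) 0 w).2.1
  have hy : logc z ≠ y := fun h => hne.2 (by rw [← h]; exact AddCircle.coe_equivIco.symm)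
  rcases hy.lt_or_gt with h | h
  · exact hz.2 (mem_interior_iff_mem_nhds.2
      ((hcont.eventually_lt_const h).mono fun w hw => ⟨hpos w, hw⟩))
  · obtain ⟨w, hw, hw'⟩ := (mem_closure_iff_frequently.1 hz.1).and_eventually
      (hcont.eventually_const_lt h) |>.exists
    exact absurd hw.2 (not_lt.2 hw'.le)

lemma tendsto_cdf_of_W2 {ι : Type*} {l : Filter ι} [l.IsCountablyGenerated]
    {νs : ι → Measure S1} {ν : Measure S1} [∀ i, IsProbabilityMeasure (νs i)]
    [IsProbabilityMeasure ν] (hac : ν ≪ volume)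
    (h : Tendsto (fun i => √(W2sq (νs i) ν)) l (𝓝 0)) (x : ℝ) :
    Tendsto (fun i => cdf (tilde (νs i)) x) l (𝓝 (cdf (tilde ν) x)) := by
  unfold cdf tilde
  simp only [Measure.map_apply measurable_logc measurableSet_Ico]
  refine tendsto_const_nhds.add ((ENNReal.tendsto_toReal (measure_ne_top _ _)).comp ?_)
  refine ProbabilityMeasure.tendsto_measure_of_null_frontier_of_tendsto'
    (tendsto_probabilityMeasure_of_W2 (νs := fun i => ⟨νs i, inferInstance⟩)
      (ν := ⟨ν, inferInstance⟩) h) (hac ?_)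
  have hpt : ∀ z : S1, volume {z} = 0 := fun z => by
    rw [← Metric.closedBall_zero, AddCircle.volume_closedBall]
    simp [Real.pi_nonneg]
  exact measure_mono_null (frontier_logc_preimage_Ico_subset _)
    (measure_union_null (hpt _) (hpt _))

/-- (a) If `W₂(ν_n, ν) → 0` then `C_{[ν_n,μ]}(θ) → C_{[ν,μ]}(θ)` for every
`θ`; (b) if `θ_n` minimises `C_{[ν_n,μ]}` and the sequence `(θ_n)` lies in a compact
interval, then every limit point of `(θ_n)` minimises `C_{[ν,μ]}`. -/
theorem stmt10 (μ : Measure S1) [IsProbabilityMeasure μ] (hacμ : μ ≪ volume)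
    (ν : Measure S1) [IsProbabilityMeasure ν] (hacν : ν ≪ volume)
    (νs : ℕ → Measure S1) [∀ n, IsProbabilityMeasure (νs n)]
    (hacνs : ∀ n, νs n ≪ volume)
    (hconv : Tendsto (fun n => Real.sqrt (W2sq (νs n) ν)) atTop (𝓝 0)) :
    (∀ θ : ℝ, Tendsto (fun n => cost (νs n) μ θ) atTop (𝓝 (cost ν μ θ))) ∧
    (∀ (θn : ℕ → ℝ), (∀ n, ∀ θ : ℝ, cost (νs n) μ (θn n) ≤ cost (νs n) μ θ) →
      (∃ a b : ℝ, ∀ n, θn n ∈ Set.Icc a b) →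
      ∀ θlim : ℝ, MapClusterPt θlim atTop θn →
        ∀ θ : ℝ, cost ν μ θlim ≤ cost ν μ θ) := by
  have hcdf := tendsto_cdf_of_W2 hacν hconv
  refine ⟨fun θ => tendsto_cost hcdf tendsto_const_nhds, ?_⟩
  intro θn hmin _ θlim hclus θ
  have hne : (atTop ⊓ comap θn (𝓝 θlim)).NeBot := by
    rw [neBot_inf_comap_iff_map, inf_comm]
    exact hclus
  have hle : atTop ⊓ comap θn (𝓝 θlim) ≤ atTop := inf_le_left
  have hθ : Tendsto θn (atTop ⊓ comap θn (𝓝 θlim)) (𝓝 θlim) :=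
    tendsto_comap.mono_left inf_le_right
  have hcdf' := fun x => (hcdf x).mono_left hle
  exact le_of_tendsto_of_tendsto' (tendsto_cost hcdf' hθ)
    (tendsto_cost hcdf' tendsto_const_nhds) fun n => hmin n θ

end
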